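/- Let γ_p denote the standard Gaussian measure on ℝ^p, let a_1, ..., a_p be unit vectors in ℝ^p and b_1, ..., b_p ∈ ℝ, and for t ∈ ℝ set K(t) = {x ∈ ℝ^p : ⟨a_j, x⟩ ≤ b_j + t for all j = 1, ..., p} with K = K(0). Then the limit lim_{δ ↓ 0} γ_p(K(δ) \ K)/δ exists and is at most √(2 log p) + 2. -/

import Mathlib

open MeasureTheory Filter
open scoped RealInnerProductSpace Topology

/-- The standard Gaussian measure `γ_p` on `ℝ^p`, given by its density
`φ_p(x) = (2π)^{−p/2} e^{−‖x‖²/2}` with respect to Lebesgue measure. -/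
noncomputable def stdGaussian (p : ℕ) : Measure (EuclideanSpace ℝ (Fin p)) :=
  volume.withDensity fun x =>
    ENNReal.ofReal ((2 * Real.pi) ^ (-(p : ℝ) / 2) * Real.exp (-‖x‖ ^ 2 / 2))

open ProbabilityTheory (gaussianPDFReal gaussianPDFReal_nonneg integrable_gaussianPDFReal
  measurable_gaussianPDFReal lintegral_gaussianPDFReal_eq_one)
open Set

/-- The standard Gaussian measure on `ℝ^p` has total mass one. -/
lemma stdGaussian_univ (p : ℕ) : stdGaussian p univ = 1 := by
  have h := GaussianFourier.integral_rexp_neg_mul_sq_norm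
    (V := EuclideanSpace ℝ (Fin p)) (b := 1 / 2) (by norm_num)
  have hpos : (0 : ℝ) < 2 * Real.pi := by positivity
  have hval : ∫ x : EuclideanSpace ℝ (Fin p),
      (2 * Real.pi) ^ (-(p : ℝ) / 2) * Real.exp (-‖x‖ ^ 2 / 2) = 1 := by
    rw [integral_const_mul]
    have e : (fun x : EuclideanSpace ℝ (Fin p) => Real.exp (-‖x‖ ^ 2 / 2))
        = fun x => Real.exp (-(1 / 2) * ‖x‖ ^ 2) := by
      ext x; congr 1; ring
    rw [e, h, finrank_euclideanSpace_fin, show Real.pi / (1 / 2) = 2 * Real.pi by ring,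
      ← Real.rpow_add hpos]
    rw [show -(p : ℝ) / 2 + p / 2 = 0 by ring, Real.rpow_zero]
  rw [stdGaussian, withDensity_apply _ MeasurableSet.univ, Measure.restrict_univ,
    ← ofReal_integral_eq_lintegral_ofReal, hval, ENNReal.ofReal_one]
  · by_contra hn
    rw [integral_undef hn] at hval
    exact zero_ne_one hval
  · exact Eventually.of_forall fun x => by positivity

instance isProbabilityMeasure_stdGaussian (p : ℕ) : IsProbabilityMeasure (stdGaussian p) :=
  ⟨stdGaussian_univ p⟩

/-- The isometric coordinates `(s, y) ↦ s • a + y` along a unit vector and its orthogonal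
complement preserve Lebesgue measure. -/
lemma measurePreserving_smul_add_orthogonal {E : Type*} [NormedAddCommGroup E]
    [InnerProductSpace ℝ E] [FiniteDimensional ℝ E] [MeasurableSpace E] [BorelSpace E]
    {a : E} (ha : ‖a‖ = 1) :
    MeasurePreserving (fun z : ℝ × (ℝ ∙ a)ᗮ => z.1 • a + (z.2 : E)) volume volume := by
  have h₁ := (LinearIsometryEquiv.toSpanUnitSingleton a ha).measurePreserving.prod
    (MeasurePreserving.id (volume : Measure (ℝ ∙ a)ᗮ))
  have h₂ := WithLp.volume_preserving_toLp (ℝ ∙ a) (ℝ ∙ a)ᗮ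
  have h₃ := (Submodule.orthogonalDecomposition (ℝ ∙ a)).symm.measurePreserving
  have h := h₃.comp (h₂.comp h₁)
  have e : (fun z : ℝ × (ℝ ∙ a)ᗮ => z.1 • a + (z.2 : E)) =
      (ℝ ∙ a).orthogonalDecomposition.symm ∘ WithLp.toLp 2 ∘
        Prod.map (LinearIsometryEquiv.toSpanUnitSingleton a ha) id := by
    rfl
  rw [e]
  exact h

/-- A set stable under nonnegative translations along a unit vector `a` meets the slabs
orthogonal to `a` in Gaussian measure `∫ φ G`, where `G` is monotone with values in `[0, 1]`. -/
lemma exists_monotone_slice {p : ℕ} {a : EuclideanSpace ℝ (Fin p)} (ha : ‖a‖ = 1)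
    {S : Set (EuclideanSpace ℝ (Fin p))} (hS : MeasurableSet S)
    (hSa : ∀ x ∈ S, ∀ s : ℝ, 0 ≤ s → x + s • a ∈ S) :
    ∃ G : ℝ → ℝ, Monotone G ∧ (∀ s, 0 ≤ G s) ∧ (∀ s, G s ≤ 1) ∧
      ∀ I : Set ℝ, MeasurableSet I →
        (stdGaussian p (S ∩ {x | ⟪a, x⟫ ∈ I})).toReal
          = ∫ s in I, gaussianPDFReal 0 1 s * G s := by
  let V := (ℝ ∙ a)ᗮ
  let c : ℝ := (2 * Real.pi) ^ (-(p : ℝ) / 2) * √(2 * Real.pi)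
  let μ : Measure V := volume.withDensity fun y => ENNReal.ofReal (c * Real.exp (-‖y‖ ^ 2 / 2))
  have hinner (s : ℝ) (y : V) : ⟪a, s • a + (y : EuclideanSpace ℝ (Fin p))⟫ = s := by
    have hy : ⟪a, (y : EuclideanSpace ℝ (Fin p))⟫ = 0 :=
      Submodule.mem_orthogonal_singleton_iff_inner_right.1 y.2
    rw [inner_add_right, inner_smul_right, hy, real_inner_self_eq_norm_sq, ha]; ring
  have hnorm (s : ℝ) (y : V) :
      ‖s • a + (y : EuclideanSpace ℝ (Fin p))‖ ^ 2 = s ^ 2 + ‖y‖ ^ 2 := by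
    have hy : ⟪a, (y : EuclideanSpace ℝ (Fin p))⟫ = 0 :=
      Submodule.mem_orthogonal_singleton_iff_inner_right.1 y.2
    rw [norm_add_sq_real, inner_smul_left, hy, norm_smul, ha]
    simp
  have hdens (s : ℝ) (y : V) :
      ENNReal.ofReal ((2 * Real.pi) ^ (-(p : ℝ) / 2) *
        Real.exp (-‖s • a + (y : EuclideanSpace ℝ (Fin p))‖ ^ 2 / 2))
      = ENNReal.ofReal (gaussianPDFReal 0 1 s) *
        ENNReal.ofReal (c * Real.exp (-‖y‖ ^ 2 / 2)) := by
    rw [← ENNReal.ofReal_mul (gaussianPDFReal_nonneg _ _ _), hnorm, gaussianPDFReal]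
    congr 1
    have hs : √(2 * Real.pi) ≠ 0 := by positivity
    simp only [NNReal.coe_one, mul_one, sub_zero, c]
    rw [show -(s ^ 2 + ‖y‖ ^ 2) / 2 = -s ^ 2 / 2 + -‖y‖ ^ 2 / 2 by ring, Real.exp_add]
    field_simp
  have hmeas : Measurable fun z : ℝ × V => z.1 • a + (z.2 : EuclideanSpace ℝ (Fin p)) := by
    fun_prop
  have key (T : Set (EuclideanSpace ℝ (Fin p))) (hT : MeasurableSet T) (I : Set ℝ)
      (hI : MeasurableSet I) :
      stdGaussian p (T ∩ {x | ⟪a, x⟫ ∈ I})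
        = ∫⁻ s in I, ENNReal.ofReal (gaussianPDFReal 0 1 s) *
            μ {y : V | s • a + (y : EuclideanSpace ℝ (Fin p)) ∈ T} := by
    have hA : MeasurableSet (T ∩ {x : EuclideanSpace ℝ (Fin p) | ⟪a, x⟫ ∈ I}) :=
      hT.inter ((by fun_prop : Measurable fun x : EuclideanSpace ℝ (Fin p) => ⟪a, x⟫) hI)
    have hF : Measurable ((T ∩ {x : EuclideanSpace ℝ (Fin p) | ⟪a, x⟫ ∈ I}).indicator fun x =>
        ENNReal.ofReal ((2 * Real.pi) ^ (-(p : ℝ) / 2) * Real.exp (-‖x‖ ^ 2 / 2))) :=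
      Measurable.indicator (by fun_prop) hA
    rw [stdGaussian, withDensity_apply _ hA, ← lintegral_indicator hA,
      ← (measurePreserving_smul_add_orthogonal ha).lintegral_comp hF, Measure.volume_eq_prod,
      lintegral_prod _ (by exact (hF.comp hmeas).aemeasurable), ← lintegral_indicator hI]
    refine lintegral_congr fun s => ?_
    have hTs : MeasurableSet {y : V | s • a + (y : EuclideanSpace ℝ (Fin p)) ∈ T} :=
      (by fun_prop : Measurable fun y : V => s • a + (y : EuclideanSpace ℝ (Fin p))) hT
    by_cases hs : s ∈ I
    · rw [indicator_of_mem hs, withDensity_apply _ hTs, ← lintegral_indicator hTs,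
        ← lintegral_const_mul _ ((by fun_prop : Measurable _).indicator hTs)]
      refine lintegral_congr fun y => ?_
      by_cases hy : s • a + (y : EuclideanSpace ℝ (Fin p)) ∈ T
      · rw [indicator_of_mem, indicator_of_mem, hdens]
        · exact hy
        · exact ⟨hy, by simpa [hinner] using hs⟩
      · rw [indicator_of_notMem, indicator_of_notMem, mul_zero]
        · exact hy
        · exact fun h => hy h.1
    · rw [indicator_of_notMem hs]
      refine (lintegral_congr fun y => ?_).trans lintegral_zero
      refine indicator_of_notMem (fun h => hs ?_) _
      simpa [hinner] using h.2
  have hμ : μ univ = 1 := by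
    have h := key univ MeasurableSet.univ univ MeasurableSet.univ
    simp only [mem_univ, ofPred_true, inter_univ, stdGaussian_univ, Measure.restrict_univ] at h
    rw [lintegral_mul_const _ (by fun_prop), lintegral_gaussianPDFReal_eq_one 0 one_ne_zero,
      one_mul] at h
    exact h.symm
  have : IsProbabilityMeasure μ := ⟨hμ⟩
  have hG : Measurable fun s : ℝ => μ {y : V | s • a + (y : EuclideanSpace ℝ (Fin p)) ∈ S} :=
    measurable_measure_prodMk_left (hmeas hS)
  refine ⟨fun s => μ.real {y : V | s • a + (y : EuclideanSpace ℝ (Fin p)) ∈ S}, ?_,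
    fun s => measureReal_nonneg, fun s => measureReal_le_one, fun I hI => ?_⟩
  · intro s t hst
    refine measureReal_mono fun y hy => ?_
    have h := hSa _ hy (t - s) (sub_nonneg.2 hst)
    simp only [mem_ofPred_eq]
    convert h using 1
    module
  · rw [key S hS I hI, integral_eq_lintegral_of_nonneg_ae]
    · congr 1
      refine lintegral_congr fun s => ?_
      rw [ENNReal.ofReal_mul (gaussianPDFReal_nonneg _ _ _), ofReal_measureReal]
    · exact Eventually.of_forall fun s =>
        mul_nonneg (gaussianPDFReal_nonneg _ _ _) measureReal_nonneg
    · exact ((measurable_gaussianPDFReal 0 1).mul hG.ennreal_toReal).aestronglyMeasurable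

lemma gaussianPDFReal_zero_one_le_of_sq_le {x y : ℝ} (h : y ^ 2 ≤ x ^ 2) :
    gaussianPDFReal 0 1 x ≤ gaussianPDFReal 0 1 y := by
  simp only [gaussianPDFReal, sub_zero, NNReal.coe_one, mul_one]
  gcongr

lemma gaussianPDFReal_zero_one_le_exp (x : ℝ) :
    gaussianPDFReal 0 1 x ≤ Real.exp (-x ^ 2 / 2) := by
  simp only [gaussianPDFReal, sub_zero, NNReal.coe_one, mul_one]
  refine mul_le_of_le_one_left (by positivity) (inv_le_one_of_one_le₀ ?_)
  rw [Real.one_le_sqrt]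
  linarith [Real.pi_gt_three]

lemma hasDerivAt_gaussianPDFReal_zero_one (x : ℝ) :
    HasDerivAt (gaussianPDFReal 0 1) (-x * gaussianPDFReal 0 1 x) x := by
  have h : HasDerivAt (fun x : ℝ => -x ^ 2 / 2) (-x) x :=
    ((hasDerivAt_pow 2 x).neg.div_const 2).congr_deriv (by simp; ring)
  have e : gaussianPDFReal 0 1 = fun y => (√(2 * Real.pi))⁻¹ * Real.exp (-y ^ 2 / 2) := by
    ext y
    simp [gaussianPDFReal]
  rw [e]
  exact (h.exp.const_mul _).congr_deriv (by ring)

/-- A Mills ratio bound for the Gaussian tail. -/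
lemma gaussianPDFReal_le_mul_tail_of_nonneg {c : ℝ} (hc : 0 ≤ c) :
    gaussianPDFReal 0 1 c ≤ (c + 1) * ∫ s in Ioi c, gaussianPDFReal 0 1 s := by
  let F : ℝ → ℝ := fun s => gaussianPDFReal 0 1 s / (s + 1)
  let F' : ℝ → ℝ := fun s => -(gaussianPDFReal 0 1 s * ((s ^ 2 + s + 1) / (s + 1) ^ 2))
  have hderiv : ∀ s ∈ Ici c, HasDerivAt F (F' s) s := fun s hs => by
    have hs1 : s + 1 ≠ 0 := by linarith [hc.trans hs]
    refine ((hasDerivAt_gaussianPDFReal_zero_one s).fun_div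
      ((hasDerivAt_id s).add_const 1) hs1).congr_deriv ?_
    simp only [F', id]
    field_simp
    ring
  have hneg : ∀ s ∈ Ioi c, F' s ≤ 0 := fun s hs => by
    have hs0 : 0 ≤ s := hc.trans (le_of_lt hs)
    have := gaussianPDFReal_nonneg 0 1 s
    simp only [F', Left.neg_nonpos_iff]
    positivity
  have hlim : Tendsto F atTop (𝓝 0) := by
    refine squeeze_zero' (g := fun s : ℝ => 1 / (s + 1)) ?_ ?_ ?_
    · filter_upwards [eventually_ge_atTop 0] with s hs
      exact div_nonneg (gaussianPDFReal_nonneg _ _ _) (by linarith)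
    · filter_upwards [eventually_ge_atTop 0] with s hs
      have : gaussianPDFReal 0 1 s ≤ 1 :=
        (gaussianPDFReal_zero_one_le_exp s).trans (Real.exp_le_one_iff.2 (by nlinarith))
      simp only [F]
      gcongr
    · exact (tendsto_atTop_add_const_right _ 1 tendsto_id).const_div_atTop 1
  have hint := integrableOn_Ioi_deriv_of_nonpos' hderiv hneg hlim
  have hval := integral_Ioi_of_hasDerivAt_of_tendsto' hderiv hint hlim
  have hle : ∫ s in Ioi c, -F' s ≤ ∫ s in Ioi c, gaussianPDFReal 0 1 s := by
    refine setIntegral_mono_on hint.neg (integrable_gaussianPDFReal 0 1).integrableOn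
      measurableSet_Ioi fun s hs => ?_
    have hs0 : 0 < s := hc.trans_lt hs
    simp only [F', neg_neg]
    refine mul_le_of_le_one_right (gaussianPDFReal_nonneg _ _ _) ?_
    rw [div_le_one (by positivity)]
    nlinarith
  rw [integral_neg, hval, zero_sub, neg_neg, div_le_iff₀ (by linarith)] at hle
  linarith

lemma gaussianPDFReal_le_mul_tail {c T : ℝ} (hT : 0 ≤ T) (hc : c ≤ T) :
    gaussianPDFReal 0 1 c ≤ (T + 1) * ∫ s in Ioi c, gaussianPDFReal 0 1 s := by
  have hmono : ∫ s in Ioi (max c 0), gaussianPDFReal 0 1 s ≤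
      ∫ s in Ioi c, gaussianPDFReal 0 1 s :=
    setIntegral_mono_set (integrable_gaussianPDFReal 0 1).integrableOn
      (Eventually.of_forall fun s => gaussianPDFReal_nonneg 0 1 s)
      (Ioi_subset_Ioi (le_max_left c 0)).eventuallyLE
  calc gaussianPDFReal 0 1 c ≤ gaussianPDFReal 0 1 (max c 0) :=
        gaussianPDFReal_zero_one_le_of_sq_le <| by
          rcases le_total c 0 with h | h
          · simp [h, sq_nonneg]
          · simp [h]
    _ ≤ (max c 0 + 1) * ∫ s in Ioi (max c 0), gaussianPDFReal 0 1 s :=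
        gaussianPDFReal_le_mul_tail_of_nonneg (le_max_right c 0)
    _ ≤ (T + 1) * ∫ s in Ioi c, gaussianPDFReal 0 1 s := by
        gcongr
        · exact integral_nonneg fun s => gaussianPDFReal_nonneg 0 1 s
        · exact max_le hc hT

lemma gaussianPDFReal_le_one_div_add {p : ℕ} (hp : 1 ≤ p) (c : ℝ) :
    gaussianPDFReal 0 1 c ≤ 1 / p +
      (√(2 * Real.log p) + 1) * ∫ s in Ioi c, gaussianPDFReal 0 1 s := by
  have hp' : (1 : ℝ) ≤ p := by exact_mod_cast hp
  have hT : 0 ≤ √(2 * Real.log p) := Real.sqrt_nonneg _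
  rcases le_total c (√(2 * Real.log p)) with h | h
  · have := gaussianPDFReal_le_mul_tail hT h
    have : (0 : ℝ) ≤ 1 / p := by positivity
    linarith
  · have hnn : 0 ≤ (√(2 * Real.log p) + 1) * ∫ s in Ioi c, gaussianPDFReal 0 1 s :=
      mul_nonneg (by linarith) (integral_nonneg fun s => gaussianPDFReal_nonneg 0 1 s)
    have hsq : 2 * Real.log p ≤ c ^ 2 := by
      rw [← Real.sq_sqrt (mul_nonneg zero_le_two (Real.log_nonneg hp'))]
      gcongr
    have hexp : Real.exp (-c ^ 2 / 2) ≤ 1 / p := by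
      have hlog : (1 : ℝ) / p = Real.exp (-Real.log p) := by
        rw [Real.exp_neg, Real.exp_log (by positivity), one_div]
      rw [hlog]
      gcongr
      linarith
    linarith [gaussianPDFReal_zero_one_le_exp c]

lemma integrable_gaussianPDFReal_mul_monotone {G : ℝ → ℝ} (hG : Monotone G)
    (hG0 : ∀ s, 0 ≤ G s) (hG1 : ∀ s, G s ≤ 1) :
    Integrable fun s => gaussianPDFReal 0 1 s * G s := by
  refine (integrable_gaussianPDFReal 0 1).mul_bdd (c := 1) hG.measurable.aestronglyMeasurable
    (Eventually.of_forall fun s => ?_)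
  rw [Real.norm_of_nonneg (hG0 s)]
  exact hG1 s

lemma tendsto_integral_Ioc_gaussianPDFReal_mul_div {G : ℝ → ℝ} (hG : Monotone G)
    (hG0 : ∀ s, 0 ≤ G s) (hG1 : ∀ s, G s ≤ 1) (c : ℝ) :
    Tendsto (fun δ : ℝ => (∫ s in Ioc c (c + δ), gaussianPDFReal 0 1 s * G s) / δ)
      (𝓝[>] 0) (𝓝 (gaussianPDFReal 0 1 c * Function.rightLim G c)) := by
  have hint := integrable_gaussianPDFReal_mul_monotone hG hG0 hG1
  have hlim : Tendsto (fun s => gaussianPDFReal 0 1 s * G s) (𝓝[>] c)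
      (𝓝 (gaussianPDFReal 0 1 c * Function.rightLim G c)) :=
    ((hasDerivAt_gaussianPDFReal_zero_one c).continuousAt.tendsto.mono_left
      nhdsWithin_le_nhds).mul (hG.tendsto_rightLim c)
  have hd : HasDerivWithinAt (fun u => ∫ s in c..u, gaussianPDFReal 0 1 s * G s)
      (gaussianPDFReal 0 1 c * Function.rightLim G c) (Ici c) c :=
    intervalIntegral.integral_hasDerivWithinAt_of_tendsto_ae_right hint.intervalIntegrable
      (hint.aestronglyMeasurable.stronglyMeasurableAtFilter) (hlim.mono_left inf_le_left)
  have hs := (hasDerivWithinAt_iff_tendsto_slope' (lt_irrefl c)).1 hd.Ioi_of_Ici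
  have hmap : Tendsto (fun δ : ℝ => c + δ) (𝓝[>] 0) (𝓝[>] c) := by
    refine tendsto_nhdsWithin_of_tendsto_nhds_of_eventually_within _ ?_ ?_
    · have : Tendsto (fun δ : ℝ => c + δ) (𝓝 0) (𝓝 (c + 0)) := by
        exact (continuous_const.add continuous_id).tendsto 0
      rw [add_zero] at this
      exact this.mono_left nhdsWithin_le_nhds
    · filter_upwards [self_mem_nhdsWithin] with δ hδ
      simpa using hδ
  refine (hs.comp hmap).congr' ?_
  filter_upwards [self_mem_nhdsWithin] with δ hδ
  have hδ' : (0 : ℝ) < δ := hδ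
  simp only [Function.comp, slope_def_field, intervalIntegral.integral_same, sub_zero,
    add_sub_cancel_left]
  rw [intervalIntegral.integral_of_le (by linarith)]

lemma rightLim_mul_tail_le {G : ℝ → ℝ} (hG : Monotone G)
    (hG0 : ∀ s, 0 ≤ G s) (hG1 : ∀ s, G s ≤ 1) (c : ℝ) :
    Function.rightLim G c * ∫ s in Ioi c, gaussianPDFReal 0 1 s
      ≤ ∫ s in Ioi c, gaussianPDFReal 0 1 s * G s := by
  rw [← integral_const_mul]
  refine setIntegral_mono_on ((integrable_gaussianPDFReal 0 1).const_mul _).integrableOn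
    (integrable_gaussianPDFReal_mul_monotone hG hG0 hG1).integrableOn measurableSet_Ioi
    fun s hs => ?_
  rw [mul_comm]
  exact mul_le_mul_of_nonneg_left (hG.rightLim_le hs) (gaussianPDFReal_nonneg _ _ _)
/-- The region where the affine functional `⟪a j, ·⟫ - b j` is maximal among all of them and `j`
is the least index with this property. -/
def firstMaxRegion {E ι : Type*} [NormedAddCommGroup E] [InnerProductSpace ℝ E] [LinearOrder ι]
    (a : ι → E) (b : ι → ℝ) (j : ι) : Set E :=
  {x | ∀ i, ⟪a i, x⟫ - b i ≤ ⟪a j, x⟫ - b j ∧ (i < j → ⟪a i, x⟫ - b i < ⟪a j, x⟫ - b j)}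

section firstMaxRegion

variable {E ι : Type*} [NormedAddCommGroup E] [InnerProductSpace ℝ E] [LinearOrder ι]
  {a : ι → E} {b : ι → ℝ}

lemma measurableSet_firstMaxRegion [Countable ι] [MeasurableSpace E] [OpensMeasurableSpace E]
    (j : ι) : MeasurableSet (firstMaxRegion a b j) := by
  have hm (i : ι) : Measurable fun x => ⟪a i, x⟫ - b i :=
    (continuous_const.inner continuous_id).measurable.sub_const _
  have h : firstMaxRegion a b j = ⋂ i, {x | ⟪a i, x⟫ - b i ≤ ⟪a j, x⟫ - b j} ∩
      {x | i < j → ⟪a i, x⟫ - b i < ⟪a j, x⟫ - b j} := by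
    ext x; simp [firstMaxRegion]
  rw [h]
  refine MeasurableSet.iInter fun i => (measurableSet_le (hm i) (hm j)).inter ?_
  by_cases hij : i < j
  · simpa [hij] using measurableSet_lt (hm i) (hm j)
  · simp [hij]

lemma add_smul_mem_firstMaxRegion (ha : ∀ i, ‖a i‖ = 1) {j : ι} {x : E}
    (hx : x ∈ firstMaxRegion a b j) {s : ℝ} (hs : 0 ≤ s) :
    x + s • a j ∈ firstMaxRegion a b j := by
  intro i
  have hij : ⟪a i, a j⟫ ≤ 1 := by simpa [ha] using real_inner_le_norm (a i) (a j)
  have hjj : ⟪a j, a j⟫ = 1 := by rw [real_inner_self_eq_norm_sq, ha, one_pow]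
  have hsi : s * ⟪a i, a j⟫ ≤ s := mul_le_of_le_one_right hs hij
  simp only [inner_add_right, inner_smul_right, hjj, mul_one]
  refine ⟨by linarith [(hx i).1], fun h => by linarith [(hx i).2 h]⟩

lemma disjoint_firstMaxRegion {i j : ι} (hij : i ≠ j) :
    Disjoint (firstMaxRegion a b i) (firstMaxRegion a b j) := by
  rw [Set.disjoint_left]
  intro x hi hj
  rcases lt_or_gt_of_ne hij with h | h
  · exact ((hj i).2 h).not_ge (hi j).1
  · exact ((hi j).2 h).not_ge (hj i).1

lemma exists_mem_firstMaxRegion [Finite ι] [Nonempty ι] (x : E) :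
    ∃ j, x ∈ firstMaxRegion a b j := by
  obtain ⟨k, hk⟩ := Finite.exists_max fun i => ⟪a i, x⟫ - b i
  obtain ⟨j, hj, hmin⟩ := (wellFounded_lt (α := ι)).has_min
    {j | ∀ i, ⟪a i, x⟫ - b i ≤ ⟪a j, x⟫ - b j} ⟨k, hk⟩
  refine ⟨j, fun i => ⟨hj i, fun hij => lt_of_not_ge fun hle => hmin i ?_ hij⟩⟩
  exact fun l => (hj l).trans hle

lemma diff_eq_iUnion_firstMaxRegion [Finite ι] [Nonempty ι] (δ : ℝ) :
    {x | ∀ j, ⟪a j, x⟫ ≤ b j + δ} \ {x | ∀ j, ⟪a j, x⟫ ≤ b j + 0} =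
      ⋃ j, firstMaxRegion a b j ∩ {x | ⟪a j, x⟫ ∈ Ioc (b j) (b j + δ)} := by
  ext x
  simp only [Set.mem_sdiff, mem_ofPred_eq, mem_iUnion, mem_inter_iff, add_zero, mem_Ioc]
  constructor
  · rintro ⟨h, h0⟩
    obtain ⟨j, hj⟩ := exists_mem_firstMaxRegion (a := a) (b := b) x
    refine ⟨j, hj, lt_of_not_ge fun hle => h0 fun i => ?_, h j⟩
    linarith [(hj i).1]
  · rintro ⟨j, hj, hlt, hle⟩
    exact ⟨fun i => by linarith [(hj i).1], fun h => (h j).not_gt hlt⟩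

end firstMaxRegion

/-- For unit vectors `a_1, …, a_p`, reals `b_1, …, b_p` and
`K(t) = {x : ⟨a_j, x⟩ ≤ b_j + t ∀j}`, `K = K(0)`, the limit
`lim_{δ ↓ 0} γ_p(K(δ) \ K)/δ` exists and is at most `√(2 log p) + 2`. -/
theorem tendsto_gaussian_boundary_polyhedron {p : ℕ} (hp : 1 ≤ p)
    (a : Fin p → EuclideanSpace ℝ (Fin p)) (ha : ∀ j, ‖a j‖ = 1) (b : Fin p → ℝ)
    (K : ℝ → Set (EuclideanSpace ℝ (Fin p)))
    (hK : ∀ t, K t = {x | ∀ j, ⟪a j, x⟫ ≤ b j + t}) :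
    ∃ L : ℝ, Tendsto (fun δ : ℝ => (stdGaussian p (K δ \ K 0)).toReal / δ)
        (𝓝[>] 0) (𝓝 L) ∧ L ≤ Real.sqrt (2 * Real.log p) + 2 := by
  have : Nonempty (Fin p) := ⟨⟨0, hp⟩⟩
  let μ := stdGaussian p
  let S := firstMaxRegion a b
  have hS (j : Fin p) : MeasurableSet (S j) := measurableSet_firstMaxRegion j
  choose G hG hG0 hG1 hint using fun j => exists_monotone_slice (ha j) (hS j)
    fun x hx s hs => add_smul_mem_firstMaxRegion ha hx hs
  let g (j : Fin p) : ℝ := Function.rightLim (G j) (b j)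
  have hSm (j : Fin p) {I : Set ℝ} (hI : MeasurableSet I) :
      MeasurableSet (S j ∩ {x | ⟪a j, x⟫ ∈ I}) :=
    (hS j).inter ((by fun_prop : Measurable fun x => ⟪a j, x⟫) hI)
  have hdisj (I : Fin p → Set ℝ) :
      Pairwise (Function.onFun Disjoint fun j => S j ∩ {x | ⟪a j, x⟫ ∈ I j}) := fun i j hij =>
    (disjoint_firstMaxRegion hij).mono inter_subset_left inter_subset_left
  have hunion (I : Fin p → Set ℝ) (hI : ∀ j, MeasurableSet (I j)) :
      μ.real (⋃ j, S j ∩ {x | ⟪a j, x⟫ ∈ I j}) =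
        ∑ j, ∫ s in I j, gaussianPDFReal 0 1 s * G j s := by
    rw [measureReal_iUnion_fintype (hdisj I) fun j => hSm j (hI j)]
    exact Finset.sum_congr rfl fun j _ => hint j (I j) (hI j)
  refine ⟨∑ j, gaussianPDFReal 0 1 (b j) * g j, ?_, ?_⟩
  · have h := tendsto_finsetSum Finset.univ fun j _ =>
      tendsto_integral_Ioc_gaussianPDFReal_mul_div (hG j) (hG0 j) (hG1 j) (b j)
    refine h.congr fun δ => ?_
    rw [← Finset.sum_div, ← hunion _ fun j => measurableSet_Ioc, hK, hK,
      diff_eq_iUnion_firstMaxRegion]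
    rfl
  · have hmass : ∑ j, g j * ∫ s in Ioi (b j), gaussianPDFReal 0 1 s ≤ 1 :=
      calc _ ≤ ∑ j, ∫ s in Ioi (b j), gaussianPDFReal 0 1 s * G j s :=
            Finset.sum_le_sum fun j _ => rightLim_mul_tail_le (hG j) (hG0 j) (hG1 j) (b j)
        _ = μ.real (⋃ j, S j ∩ {x | ⟪a j, x⟫ ∈ Ioi (b j)}) :=
            (hunion _ fun j => measurableSet_Ioi).symm
        _ ≤ 1 := measureReal_le_one
    have hg0 (j : Fin p) : 0 ≤ g j := (hG0 j _).trans ((hG j).le_rightLim le_rfl)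
    have hg1 (j : Fin p) : g j ≤ 1 := ((hG j).rightLim_le (lt_add_one _)).trans (hG1 j _)
    have hp0 : (p : ℝ) ≠ 0 := by positivity
    calc ∑ j, gaussianPDFReal 0 1 (b j) * g j
        ≤ ∑ j, (1 / (p : ℝ) + (√(2 * Real.log p) + 1) *
            (g j * ∫ s in Ioi (b j), gaussianPDFReal 0 1 s)) := by
          refine Finset.sum_le_sum fun j _ => ?_
          have h := mul_le_mul_of_nonneg_right (gaussianPDFReal_le_one_div_add hp (b j)) (hg0 j)
          have h1 : 1 / (p : ℝ) * g j ≤ 1 / p := mul_le_of_le_one_right (by positivity) (hg1 j)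
          linarith
      _ = 1 + (√(2 * Real.log p) + 1) *
            ∑ j, g j * ∫ s in Ioi (b j), gaussianPDFReal 0 1 s := by
          rw [Finset.sum_add_distrib, ← Finset.mul_sum]
          simp [hp0]
      _ ≤ 1 + (√(2 * Real.log p) + 1) * 1 := by gcongr
      _ = √(2 * Real.log p) + 2 := by ring
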